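/- Suppose Θ̄ = −Θ. For all m₁, m₂, n₁, n₂ ∈ ℕ with n₁ ≥ m₁ and n₂ ≥ m₂, the product state b^{(4)}_{m,n}(q¹,π¹,q²,π²) = f_{m₁,n₁}(q¹,π¹) f_{m₂,n₂}(q²,π²) is a left star-eigenfunction of the full Hamiltonian H: b^{(4)}_{m,n} ⋆ H = E^L_{0,n} b^{(4)}_{m,n} with E^L_{0,n} = ħ(1 + Θ²/(4ħ²))(n₁ + n₂ + 1). -/

import Mathlib

open Complex Real

/-- Phase-space functions on ℝ⁴ with coordinates (q¹, π¹, q², π²). -/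
abbrev PhaseFn := ℝ → ℝ → ℝ → ℝ → ℂ

/-- Partial derivative with respect to q¹. -/
noncomputable def pdQ1 (F : PhaseFn) : PhaseFn :=
  fun q1 p1 q2 p2 => deriv (fun t => F t p1 q2 p2) q1

/-- Partial derivative with respect to π¹. -/
noncomputable def pdP1 (F : PhaseFn) : PhaseFn :=
  fun q1 p1 q2 p2 => deriv (fun t => F q1 t q2 p2) p1

/-- Partial derivative with respect to q². -/
noncomputable def pdQ2 (F : PhaseFn) : PhaseFn :=
  fun q1 p1 q2 p2 => deriv (fun t => F q1 p1 t p2) q2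

/-- Partial derivative with respect to π². -/
noncomputable def pdP2 (F : PhaseFn) : PhaseFn :=
  fun q1 p1 q2 p2 => deriv (fun t => F q1 p1 q2 t) p2

/-- The family (∂_{q^l})_{l=1,2}. -/
noncomputable def dQ : Fin 2 → PhaseFn → PhaseFn := ![pdQ1, pdQ2]

/-- The family (∂_{π^l})_{l=1,2}. -/
noncomputable def dP : Fin 2 → PhaseFn → PhaseFn := ![pdP1, pdP2]

/-- First-order bidifferential operator
`P₁(f,g) = Σ_l (∂_{q^l} f ∂_{π^l} g − ∂_{π^l} f ∂_{q^l} g)`. -/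
noncomputable def P1 (F G : PhaseFn) : PhaseFn :=
  fun q1 p1 q2 p2 =>
    ∑ l : Fin 2,
      (dQ l F q1 p1 q2 p2 * dP l G q1 p1 q2 p2 -
        dP l F q1 p1 q2 p2 * dQ l G q1 p1 q2 p2)

/-- Second-order bidifferential operator
`P₂(f,g) = Σ_{l,l'} (∂_{q^l}∂_{q^{l'}} f ∂_{π^l}∂_{π^{l'}} g
  − 2 ∂_{q^l}∂_{π^{l'}} f ∂_{π^l}∂_{q^{l'}} g + ∂_{π^l}∂_{π^{l'}} f ∂_{q^l}∂_{q^{l'}} g)`. -/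
noncomputable def P2 (F G : PhaseFn) : PhaseFn :=
  fun q1 p1 q2 p2 =>
    ∑ l : Fin 2, ∑ l' : Fin 2,
      (dQ l (dQ l' F) q1 p1 q2 p2 * dP l (dP l' G) q1 p1 q2 p2 -
        2 * dQ l (dP l' F) q1 p1 q2 p2 * dP l (dQ l' G) q1 p1 q2 p2 +
        dP l (dP l' F) q1 p1 q2 p2 * dQ l (dQ l' G) q1 p1 q2 p2)

/-- Moyal star product, truncated (exactly) at second order:
valid when one factor is a polynomial of degree ≤ 2, in which case
`f ⋆ g = fg + (iℏ/2)P₁(f,g) + (1/2)(iℏ/2)² P₂(f,g)`. -/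
noncomputable def moyal (ℏ : ℝ) (F G : PhaseFn) : PhaseFn :=
  fun q1 p1 q2 p2 =>
    F q1 p1 q2 p2 * G q1 p1 q2 p2 +
      (Complex.I * (ℏ : ℂ) / 2) * P1 F G q1 p1 q2 p2 +
      (1 / 2) * (Complex.I * (ℏ : ℂ) / 2) ^ 2 * P2 F G q1 p1 q2 p2

/-- `H₀ = ½((q¹)² + (q²)² + (π¹)² + (π²)²)`. -/
noncomputable def H0 : PhaseFn :=
  fun q1 p1 q2 p2 => (((q1 ^ 2 + q2 ^ 2 + p1 ^ 2 + p2 ^ 2) / 2 : ℝ) : ℂ)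

/-- `H_L = −((Θ+Θ̄)/2ℏ)(q¹π² − q²π¹)`. -/
noncomputable def HL (ℏ Θ Θbar : ℝ) : PhaseFn :=
  fun q1 p1 q2 p2 => ((-((Θ + Θbar) / (2 * ℏ)) * (q1 * p2 - q2 * p1) : ℝ) : ℂ)

/-- `H_q = (Θ̄²/8ℏ²)((q¹)² + (q²)²)`. -/
noncomputable def Hq (ℏ Θbar : ℝ) : PhaseFn :=
  fun q1 p1 q2 p2 => ((Θbar ^ 2 / (8 * ℏ ^ 2) * (q1 ^ 2 + q2 ^ 2) : ℝ) : ℂ)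

/-- `H_π = (Θ²/8ℏ²)((π¹)² + (π²)²)`. -/
noncomputable def Hpi (ℏ Θ : ℝ) : PhaseFn :=
  fun q1 p1 q2 p2 => ((Θ ^ 2 / (8 * ℏ ^ 2) * (p1 ^ 2 + p2 ^ 2) : ℝ) : ℂ)

/-- Generalized Laguerre polynomial
`L_m^α(x) = Σ_{k=0}^{m} (Γ(m+α+1)/Γ(k+α+1)) (−x)^k/(k!(m−k)!)` (natural α). -/
noncomputable def genLaguerre (m α : ℕ) (x : ℝ) : ℝ :=
  ∑ k ∈ Finset.range (m + 1),
    (Real.Gamma ((m : ℝ) + α + 1) / Real.Gamma ((k : ℝ) + α + 1)) * (-x) ^ k /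
      ((k.factorial : ℝ) * ((m - k).factorial : ℝ))

/-- Wigner eigenfunction
`f_{m,n}(q,π) = 2(−1)^m √(m!/n!) (2/ℏ)^{(n−m)/2} (q+iπ)^{n−m}
  L_m^{n−m}(2(q²+π²)/ℏ) e^{−(q²+π²)/ℏ}` (for n ≥ m). -/
noncomputable def wignerF (ℏ : ℝ) (m n : ℕ) (q p : ℝ) : ℂ :=
  2 * (-1) ^ m * (Real.sqrt ((m.factorial : ℝ) / (n.factorial : ℝ)) : ℂ) *
    ((Real.sqrt (2 / ℏ) : ℂ)) ^ (n - m) * ((q : ℂ) + Complex.I * (p : ℂ)) ^ (n - m) *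
    ((genLaguerre m (n - m) (2 * (q ^ 2 + p ^ 2) / ℏ) : ℝ) : ℂ) *
    (Real.exp (-(q ^ 2 + p ^ 2) / ℏ) : ℂ)

/-- Product state `b⁴_{m,n}(q¹,π¹,q²,π²) = f_{m₁,n₁}(q¹,π¹) f_{m₂,n₂}(q²,π²)`. -/
noncomputable def b4 (ℏ : ℝ) (m1 n1 m2 n2 : ℕ) : PhaseFn :=
  fun q1 p1 q2 p2 => wignerF ℏ m1 n1 q1 p1 * wignerF ℏ m2 n2 q2 p2

open Polynomial in
/-- The generalized Laguerre polynomial `L_m^α` as an element of `ℝ[X]`. -/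
noncomputable def laguerrePoly (m α : ℕ) : ℝ[X] :=
  ∑ k ∈ Finset.range (m + 1), monomial k
    (((m + α).factorial : ℝ) / ((k + α).factorial : ℝ) * (-1) ^ k /
      ((k.factorial : ℝ) * ((m - k).factorial : ℝ)))

theorem genLaguerre_eq_eval (m α : ℕ) (x : ℝ) :
    genLaguerre m α x = (laguerrePoly m α).eval x := by
  have hΓ (k : ℕ) : Real.Gamma ((k : ℝ) + α + 1) = ((k + α).factorial : ℝ) := by
    rw [← Real.Gamma_nat_eq_factorial]
    push_cast
    rfl
  simp only [genLaguerre, laguerrePoly, Polynomial.eval_finsetSum, Polynomial.eval_monomial, hΓ]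
  refine Finset.sum_congr rfl fun k _ => ?_
  rw [neg_pow]
  ring

theorem coeff_laguerrePoly (m α k : ℕ) :
    (laguerrePoly m α).coeff k = if k ≤ m then
      ((m + α).factorial : ℝ) / ((k + α).factorial : ℝ) * (-1) ^ k /
        ((k.factorial : ℝ) * ((m - k).factorial : ℝ)) else 0 := by
  simp [laguerrePoly, Polynomial.coeff_monomial]

theorem coeff_succ_laguerrePoly (m α k : ℕ) :
    ((k : ℝ) + 1) * (k + α + 1) * (laguerrePoly m α).coeff (k + 1) =
      ((k : ℝ) - m) * (laguerrePoly m α).coeff k := by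
  rw [coeff_laguerrePoly, coeff_laguerrePoly]
  rcases lt_trichotomy k m with h | rfl | h
  · obtain ⟨d, rfl⟩ := Nat.exists_eq_add_of_lt h
    rw [if_pos (by lia), if_pos (by lia), show k + d + 1 - (k + 1) = d by lia,
      show k + d + 1 - k = d + 1 by lia, show k + 1 + α = k + α + 1 by lia,
      Nat.factorial_succ (k + α), Nat.factorial_succ k, Nat.factorial_succ d]
    have h₁ : ((k + α).factorial : ℝ) ≠ 0 := by positivity
    have h₂ : (k.factorial : ℝ) ≠ 0 := by positivity
    have h₃ : (d.factorial : ℝ) ≠ 0 := by positivity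
    have h₄ : (k : ℝ) + α + 1 ≠ 0 := by positivity
    push_cast
    field_simp
    ring
  · simp
  · simp [show ¬ k ≤ m by lia, show ¬ k + 1 ≤ m by lia]

open Polynomial in
/-- Laguerre's differential equation `x L'' + (α + 1 - x) L' + m L = 0`. -/
theorem laguerrePoly_ode (m α : ℕ) :
    X * derivative (derivative (laguerrePoly m α)) +
      (C ((α : ℝ) + 1) - X) * derivative (laguerrePoly m α) +
      C (m : ℝ) * laguerrePoly m α = 0 := by
  ext k
  have h := coeff_succ_laguerrePoly m α k
  rcases k with _ | k
  · simp [sub_mul, coeff_derivative] at h ⊢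
    linear_combination h
  · simp only [sub_mul, coeff_add, coeff_sub, coeff_X_mul, coeff_C_mul, coeff_derivative,
      coeff_zero]
    push_cast at h ⊢
    linear_combination h

section RadialFunctions

variable {g g' g'' : ℝ → ℂ} (a : ℕ)

theorem hasDerivAt_add_I_mul_pow_fst (q p : ℝ) :
    HasDerivAt (fun t : ℝ => ((t : ℂ) + I * p) ^ a) (a * ((q : ℂ) + I * p) ^ (a - 1)) q := by
  simpa using ((hasDerivAt_id q).ofReal_comp.add_const (I * (p : ℂ))).fun_pow a

theorem hasDerivAt_add_I_mul_pow_snd (q p : ℝ) :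
    HasDerivAt (fun t : ℝ => ((q : ℂ) + I * t) ^ a) (a * ((q : ℂ) + I * p) ^ (a - 1) * I) p := by
  simpa using (((hasDerivAt_id p).ofReal_comp.const_mul I).const_add (q : ℂ)).fun_pow a

theorem HasDerivAt.comp_sq_add_sq_fst (hg : ∀ r, HasDerivAt g (g' r) r) (q p : ℝ) :
    HasDerivAt (fun t : ℝ => g (t ^ 2 + p ^ 2)) (2 * q * g' (q ^ 2 + p ^ 2)) q := by
  have h : HasDerivAt (fun t : ℝ => t ^ 2 + p ^ 2) (2 * q) q := by
    simpa using (hasDerivAt_pow 2 q).add_const (p ^ 2)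
  simpa [Function.comp_def] using (hg (q ^ 2 + p ^ 2)).scomp q h

theorem HasDerivAt.comp_sq_add_sq_snd (hg : ∀ r, HasDerivAt g (g' r) r) (q p : ℝ) :
    HasDerivAt (fun t : ℝ => g (q ^ 2 + t ^ 2)) (2 * p * g' (q ^ 2 + p ^ 2)) p := by
  simpa only [add_comm] using HasDerivAt.comp_sq_add_sq_fst hg p q

theorem deriv_pow_mul_radial_fst (hg : ∀ r, HasDerivAt g (g' r) r) (q p : ℝ) :
    deriv (fun t : ℝ => ((t : ℂ) + I * p) ^ a * g (t ^ 2 + p ^ 2)) q =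
      a * ((q : ℂ) + I * p) ^ (a - 1) * g (q ^ 2 + p ^ 2) +
        ((q : ℂ) + I * p) ^ a * (2 * q * g' (q ^ 2 + p ^ 2)) :=
  ((hasDerivAt_add_I_mul_pow_fst a q p).mul (HasDerivAt.comp_sq_add_sq_fst hg q p)).deriv

theorem deriv_pow_mul_radial_snd (hg : ∀ r, HasDerivAt g (g' r) r) (q p : ℝ) :
    deriv (fun t : ℝ => ((q : ℂ) + I * t) ^ a * g (q ^ 2 + t ^ 2)) p =
      a * ((q : ℂ) + I * p) ^ (a - 1) * I * g (q ^ 2 + p ^ 2) +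
        ((q : ℂ) + I * p) ^ a * (2 * p * g' (q ^ 2 + p ^ 2)) :=
  ((hasDerivAt_add_I_mul_pow_snd a q p).mul (HasDerivAt.comp_sq_add_sq_snd hg q p)).deriv

theorem natCast_mul_pow_pred_mul (z : ℂ) : (a : ℂ) * z ^ (a - 1) * z = a * z ^ a := by
  rcases a with _ | a
  · simp
  · rw [Nat.add_sub_cancel, pow_succ]
    ring

/-- The rotation generator acts on `(q + ip)^a g(q² + p²)` by the scalar `-ia`. -/
theorem angular_deriv_pow_mul_radial (hg : ∀ r, HasDerivAt g (g' r) r) (q p : ℝ) :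
    deriv (fun t : ℝ => ((t : ℂ) + I * p) ^ a * g (t ^ 2 + p ^ 2)) q * p -
      deriv (fun t : ℝ => ((q : ℂ) + I * t) ^ a * g (q ^ 2 + t ^ 2)) p * q =
      -I * a * (((q : ℂ) + I * p) ^ a * g (q ^ 2 + p ^ 2)) := by
  rw [deriv_pow_mul_radial_fst a hg, deriv_pow_mul_radial_snd a hg]
  linear_combination (-I * g (q ^ 2 + p ^ 2)) * natCast_mul_pow_pred_mul a ((q : ℂ) + I * p) +
    (a * ((q : ℂ) + I * p) ^ (a - 1) * p * g (q ^ 2 + p ^ 2)) * I_sq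

/-- The Laplacian of `(q + ip)^a g(q² + p²)`. -/
theorem laplacian_pow_mul_radial (hg : ∀ r, HasDerivAt g (g' r) r)
    (hg' : ∀ r, HasDerivAt g' (g'' r) r) (q p : ℝ) :
    deriv (fun s : ℝ => deriv (fun t : ℝ => ((t : ℂ) + I * p) ^ a * g (t ^ 2 + p ^ 2)) s) q +
      deriv (fun s : ℝ => deriv (fun t : ℝ => ((q : ℂ) + I * t) ^ a * g (q ^ 2 + t ^ 2)) s) p =
      ((q : ℂ) + I * p) ^ a * (4 * ((q : ℂ) ^ 2 + (p : ℂ) ^ 2) * g'' (q ^ 2 + p ^ 2) +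
        4 * ((a : ℂ) + 1) * g' (q ^ 2 + p ^ 2)) := by
  have hlin (x : ℝ) : HasDerivAt (fun t : ℝ => 2 * (t : ℂ)) 2 x := by
    simpa using (hasDerivAt_id x).ofReal_comp.const_mul (2 : ℂ)
  simp only [deriv_pow_mul_radial_fst a hg, deriv_pow_mul_radial_snd a hg]
  rw [((((hasDerivAt_add_I_mul_pow_fst (a - 1) q p).const_mul (a : ℂ)).fun_mul
      (HasDerivAt.comp_sq_add_sq_fst hg q p)).fun_add ((hasDerivAt_add_I_mul_pow_fst a q p).fun_mul
      ((hlin q).fun_mul (HasDerivAt.comp_sq_add_sq_fst hg' q p)))).deriv,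
    (((((hasDerivAt_add_I_mul_pow_snd (a - 1) q p).const_mul (a : ℂ)).mul_const I).fun_mul
      (HasDerivAt.comp_sq_add_sq_snd hg q p)).fun_add ((hasDerivAt_add_I_mul_pow_snd a q p).fun_mul
      ((hlin p).fun_mul (HasDerivAt.comp_sq_add_sq_snd hg' q p)))).deriv]
  linear_combination (4 * g' (q ^ 2 + p ^ 2)) * natCast_mul_pow_pred_mul a ((q : ℂ) + I * p) +
    (a * ((a - 1 : ℕ) * ((q : ℂ) + I * p) ^ (a - 1 - 1)) * g (q ^ 2 + p ^ 2)) * I_sq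

end RadialFunctions

/-- The radial profile `c L_m^a(2r/ℏ) e^{-r/ℏ}` and its first two derivatives. -/
theorem exists_deriv_laguerre_mul_exp (ℏ : ℝ) (hℏ : ℏ ≠ 0) (m a : ℕ) (c : ℂ) :
    ∃ g' g'' : ℝ → ℂ,
      (∀ r, HasDerivAt (fun r : ℝ => c * ((genLaguerre m a (2 * r / ℏ) : ℝ) : ℂ) *
        (Real.exp (-r / ℏ) : ℂ)) (g' r) r) ∧
      (∀ r, HasDerivAt g' (g'' r) r) ∧
      ∀ r : ℝ, (ℏ : ℂ) ^ 2 / 2 * (r * g'' r + (a + 1) * g' r) =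
        (r / 2 - ℏ * (m + (a : ℂ) / 2 + 1 / 2)) *
          (c * ((genLaguerre m a (2 * r / ℏ) : ℝ) : ℂ) * (Real.exp (-r / ℏ) : ℂ)) := by
  have hE (r : ℝ) : HasDerivAt (fun r : ℝ => Real.exp (-r / ℏ))
      (Real.exp (-r / ℏ) * (-1 / ℏ)) r :=
    ((hasDerivAt_id r).neg.div_const ℏ).exp
  have hP (P : Polynomial ℝ) (r : ℝ) : HasDerivAt (fun r : ℝ => P.eval (2 * r / ℏ))
      (P.derivative.eval (2 * r / ℏ) * (2 / ℏ)) r := by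
    have h : HasDerivAt (fun r : ℝ => 2 * r / ℏ) (2 / ℏ) r := by
      simpa using ((hasDerivAt_id r).const_mul 2).div_const ℏ
    exact (P.hasDerivAt (2 * r / ℏ)).comp r h
  set P := laguerrePoly m a with hPdef
  simp only [genLaguerre_eq_eval, ← hPdef]
  have h₁ (r : ℝ) := (hP P r).fun_mul (hE r)
  have h₂ (r : ℝ) := (((hP P.derivative r).mul_const (2 / ℏ)).fun_mul (hE r)).fun_add
    ((hP P r).fun_mul ((hE r).mul_const (-1 / ℏ)))
  refine ⟨_, _, fun r => ?_, fun r => (h₂ r).ofReal_comp.const_mul c, fun r => ?_⟩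
  · simpa [mul_assoc] using (h₁ r).ofReal_comp.const_mul c
  · have hode := congrArg (Polynomial.eval (2 * r / ℏ)) (laguerrePoly_ode m a)
    simp only [← hPdef, Polynomial.eval_add, Polynomial.eval_sub, Polynomial.eval_mul,
      Polynomial.eval_X, Polynomial.eval_C, Polynomial.eval_zero] at hode
    have hodeC := congrArg (fun x : ℝ => (x : ℂ)) hode
    have hℏC : (ℏ : ℂ) ≠ 0 := ofReal_ne_zero.2 hℏ
    push_cast at hodeC ⊢
    generalize Complex.exp (-r / ℏ) = E
    field_simp at hodeC ⊢
    linear_combination (2 * c * E) * hodeC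

/-- A Wigner function is a left star-eigenfunction of the one-mode harmonic oscillator. -/
theorem wignerF_star_oscillator (ℏ : ℝ) (hℏ : ℏ ≠ 0) {m n : ℕ} (h : m ≤ n) (q p : ℝ) :
    wignerF ℏ m n q p * (((q : ℂ) ^ 2 + (p : ℂ) ^ 2) / 2) +
      I * ℏ / 2 * (deriv (fun t => wignerF ℏ m n t p) q * p -
        deriv (fun t => wignerF ℏ m n q t) p * q) +
      1 / 2 * (I * ℏ / 2) ^ 2 * (deriv (fun s => deriv (fun t => wignerF ℏ m n t p) s) q +
        deriv (fun s => deriv (fun t => wignerF ℏ m n q t) s) p) =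
      ℏ * ((n : ℂ) + 1 / 2) * wignerF ℏ m n q p := by
  obtain ⟨g', g'', hg, hg', hode⟩ := exists_deriv_laguerre_mul_exp ℏ hℏ m (n - m)
    (2 * (-1) ^ m * (Real.sqrt ((m.factorial : ℝ) / (n.factorial : ℝ)) : ℂ) *
      ((Real.sqrt (2 / ℏ) : ℂ)) ^ (n - m))
  set g : ℝ → ℂ := fun r => 2 * (-1) ^ m *
    (Real.sqrt ((m.factorial : ℝ) / (n.factorial : ℝ)) : ℂ) *
    ((Real.sqrt (2 / ℏ) : ℂ)) ^ (n - m) * ((genLaguerre m (n - m) (2 * r / ℏ) : ℝ) : ℂ) *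
    (Real.exp (-r / ℏ) : ℂ) with hgdef
  have hW (x y : ℝ) : wignerF ℏ m n x y = ((x : ℂ) + I * y) ^ (n - m) * g (x ^ 2 + y ^ 2) := by
    simp only [wignerF, hgdef]
    ring
  have hode' : (ℏ : ℂ) ^ 2 / 2 * (((q ^ 2 + p ^ 2 : ℝ) : ℂ) * g'' (q ^ 2 + p ^ 2) +
      ((n - m : ℕ) + 1) * g' (q ^ 2 + p ^ 2)) = (((q ^ 2 + p ^ 2 : ℝ) : ℂ) / 2 -
      ℏ * (m + ((n - m : ℕ) : ℂ) / 2 + 1 / 2)) * g (q ^ 2 + p ^ 2) := hode (q ^ 2 + p ^ 2)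
  simp only [hW]
  rw [angular_deriv_pow_mul_radial _ hg, laplacian_pow_mul_radial _ hg hg']
  have hnm : (n : ℂ) = m + (n - m : ℕ) := by
    rw [← Nat.cast_add, Nat.add_sub_cancel' h]
  rw [hnm]
  push_cast at hode'
  generalize ((q : ℂ) + I * p) ^ (n - m) = Z at *
  generalize ((n - m : ℕ) : ℂ) = a at *
  linear_combination (-Z) * hode' + (Z * (-ℏ * a / 2 * g (q ^ 2 + p ^ 2) + ℏ ^ 2 / 8 *
    (4 * ((q : ℂ) ^ 2 + (p : ℂ) ^ 2) * g'' (q ^ 2 + p ^ 2) + 4 * (a + 1) * g' (q ^ 2 + p ^ 2)))) *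
    I_sq

/-- The star product of a product function with an isotropic quadratic Hamiltonian splits into
one-mode contributions. -/
theorem moyal_mul_isotropic (ℏ : ℝ) (F G : ℝ → ℝ → ℂ) (c : ℂ) (q1 p1 q2 p2 : ℝ) :
    moyal ℏ (fun a b x y => F a b * G x y)
        (fun a b x y => c * (((a : ℂ) ^ 2 + (b : ℂ) ^ 2 + (x : ℂ) ^ 2 + (y : ℂ) ^ 2) / 2))
        q1 p1 q2 p2 =
      c * ((F q1 p1 * (((q1 : ℂ) ^ 2 + (p1 : ℂ) ^ 2) / 2) +
        I * ℏ / 2 * (deriv (fun t => F t p1) q1 * p1 - deriv (fun t => F q1 t) p1 * q1) +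
        1 / 2 * (I * ℏ / 2) ^ 2 * (deriv (fun s => deriv (fun t => F t p1) s) q1 +
          deriv (fun s => deriv (fun t => F q1 t) s) p1)) * G q2 p2 +
      F q1 p1 * (G q2 p2 * (((q2 : ℂ) ^ 2 + (p2 : ℂ) ^ 2) / 2) +
        I * ℏ / 2 * (deriv (fun t => G t p2) q2 * p2 - deriv (fun t => G q2 t) p2 * q2) +
        1 / 2 * (I * ℏ / 2) ^ 2 * (deriv (fun s => deriv (fun t => G t p2) s) q2 +
          deriv (fun s => deriv (fun t => G q2 t) s) p2))) := by
  have hsq (u v : ℂ) (x : ℝ) :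
      deriv (fun t : ℝ => c * ((u + (t : ℂ) ^ 2 + v) / 2)) x = c * x := by
    have h := (((((hasDerivAt_id x).ofReal_comp.pow 2).const_add u).add_const v).div_const
      2).const_mul c
    refine (h.congr_deriv ?_).deriv
    simp
  have hlin (x : ℝ) : deriv (fun t : ℝ => c * (t : ℂ)) x = c := by
    simpa using ((hasDerivAt_id x).ofReal_comp.const_mul c).deriv
  have e1 (b x y t : ℝ) : c * (((t : ℂ) ^ 2 + (b : ℂ) ^ 2 + (x : ℂ) ^ 2 + (y : ℂ) ^ 2) / 2) =
      c * ((0 + (t : ℂ) ^ 2 + ((b : ℂ) ^ 2 + (x : ℂ) ^ 2 + (y : ℂ) ^ 2)) / 2) := by ring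
  have d1 (b x y t : ℝ) : deriv (fun t : ℝ =>
      c * (((t : ℂ) ^ 2 + (b : ℂ) ^ 2 + (x : ℂ) ^ 2 + (y : ℂ) ^ 2) / 2)) t = c * t := by
    simp only [e1, hsq]
  have d2 (a x y t : ℝ) : deriv (fun t : ℝ =>
      c * (((a : ℂ) ^ 2 + (t : ℂ) ^ 2 + (x : ℂ) ^ 2 + (y : ℂ) ^ 2) / 2)) t = c * t := by
    simpa only [add_assoc] using hsq ((a : ℂ) ^ 2) ((x : ℂ) ^ 2 + (y : ℂ) ^ 2) t
  have d3 (a b y t : ℝ) : deriv (fun t : ℝ =>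
      c * (((a : ℂ) ^ 2 + (b : ℂ) ^ 2 + (t : ℂ) ^ 2 + (y : ℂ) ^ 2) / 2)) t = c * t :=
    hsq ((a : ℂ) ^ 2 + (b : ℂ) ^ 2) ((y : ℂ) ^ 2) t
  have d4 (a b x t : ℝ) : deriv (fun t : ℝ =>
      c * (((a : ℂ) ^ 2 + (b : ℂ) ^ 2 + (x : ℂ) ^ 2 + (t : ℂ) ^ 2) / 2)) t = c * t := by
    simpa only [add_zero] using hsq ((a : ℂ) ^ 2 + (b : ℂ) ^ 2 + (x : ℂ) ^ 2) 0 t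
  simp only [moyal, P1, P2, dQ, dP, Fin.sum_univ_two, Matrix.cons_val_zero, Matrix.cons_val_one,
    pdQ1, pdQ2, pdP1, pdP2, d1, d2, d3, d4, hlin, deriv_const, deriv_mul_const_field,
    deriv_const_mul_field]
  ring

/-- if Θ̄ = −Θ then, for n₁ ≥ m₁ and n₂ ≥ m₂, the product state
`b⁴_{m,n}` is a left star-eigenfunction of the full Hamiltonian
`H = H₀ + H_L + H_q + H_π`:
`b⁴_{m,n} ⋆ H = ℏ(1 + Θ²/(4ℏ²))(n₁ + n₂ + 1) b⁴_{m,n}`. -/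
theorem b4_star_H_of_theta_antisymmetric (ℏ Θ Θbar : ℝ) (hℏ : 0 < ℏ)
    (hΘ : Θbar = -Θ) (m1 m2 n1 n2 : ℕ) (h1 : m1 ≤ n1) (h2 : m2 ≤ n2) :
    moyal ℏ (b4 ℏ m1 n1 m2 n2)
        (fun a b c d =>
          H0 a b c d + HL ℏ Θ Θbar a b c d + Hq ℏ Θbar a b c d + Hpi ℏ Θ a b c d) =
      fun q1 p1 q2 p2 =>
        (((ℏ * (1 + Θ ^ 2 / (4 * ℏ ^ 2)) : ℝ)) : ℂ) * ((n1 : ℂ) + (n2 : ℂ) + 1) *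
          b4 ℏ m1 n1 m2 n2 q1 p1 q2 p2 := by
  have hH : (fun a b x y : ℝ =>
      H0 a b x y + HL ℏ Θ Θbar a b x y + Hq ℏ Θbar a b x y + Hpi ℏ Θ a b x y) =
      fun a b x y : ℝ => ((1 + Θ ^ 2 / (4 * ℏ ^ 2) : ℝ) : ℂ) *
        (((a : ℂ) ^ 2 + (b : ℂ) ^ 2 + (x : ℂ) ^ 2 + (y : ℂ) ^ 2) / 2) := by
    funext a b x y
    simp only [H0, HL, Hq, Hpi, hΘ]
    push_cast
    ring
  funext q1 p1 q2 p2
  rw [hH]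
  refine (moyal_mul_isotropic ℏ (wignerF ℏ m1 n1) (wignerF ℏ m2 n2) _ q1 p1 q2 p2).trans ?_
  rw [wignerF_star_oscillator ℏ hℏ.ne' h1, wignerF_star_oscillator ℏ hℏ.ne' h2, b4]
  push_cast
  ring
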